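/- Consider a rooted tree T on n leaves with all internal-node degrees at least 2, and the heavy-path decomposition defined as follows with parameter ν ∈ (0,1): each node x gets tag σ_x, initially |L(x)| (number of leaves below x); processing nodes in preorder, if a child x_j of x satisfies σ_{x_j} > (1 − ν/2)·σ_x, set σ_{x_j} := σ_x and put the edge {x, x_j} in the decomposition. Then every root-to-leaf path in T intersects at most O(ν^{-1}·log n) heavy paths of the resulting decomposition. -/

import Mathlib

open scoped Classical

/-- A finite rooted tree, given by parent pointers: every non-root node has a
parent, and every node reaches the root by following parents. -/
structure RTree (V : Type*) where
  root : V
  parent : V → Option V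
  parent_root : parent root = none
  parent_ne_root : ∀ v, v ≠ root → (parent v).isSome
  reaches_root : ∀ v, Relation.ReflTransGen (fun a b => parent a = some b) v root

/-- The children of a node. -/
noncomputable def RTree.children {V : Type*} [Fintype V] (T : RTree V) (v : V) : Finset V :=
  Finset.univ.filter (fun u => T.parent u = some v)

/-- `T.ancestor x u` : `x` is a (weak) ancestor of `u`. -/
def RTree.ancestor {V : Type*} (T : RTree V) (x u : V) : Prop :=
  Relation.ReflTransGen (fun a b => T.parent a = some b) u x

/-- The leaves in the subtree rooted at `x`. -/
noncomputable def RTree.leavesBelow {V : Type*} [Fintype V] (T : RTree V) (x : V) : Finset V :=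
  Finset.univ.filter (fun u => T.children u = ∅ ∧ T.ancestor x u)

/-- Heavy-path decomposition claim: given tags `σ` (initially the subtree leaf
counts, inherited along heavy edges) and the heavy-edge predicate of the
decomposition with parameter `ν`, every root-to-leaf path meets at most
`O(ν⁻¹·log n)` heavy paths (counted via its non-heavy nodes). -/
theorem stmt_5 :
    ∃ C : ℝ, 0 < C ∧
      ∀ (V : Type) [Fintype V] (T : RTree V) (ν : ℝ) (σ : V → ℕ)
        (heavy : V → Prop) (n : ℕ),
        0 < ν → ν < 1 → 2 ≤ n →
        n = (Finset.univ.filter (fun v : V => T.children v = ∅)).card →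
        (∀ v, T.children v ≠ ∅ → 2 ≤ (T.children v).card) →
        σ T.root = n →
        (∀ v, (T.leavesBelow v).card ≤ σ v) →
        ¬ heavy T.root →
        (∀ v u, T.parent v = some u → heavy v → σ v = σ u) →
        (∀ v u, T.parent v = some u → ¬ heavy v → (σ v : ℝ) ≤ (1 - ν / 2) * (σ u : ℝ)) →
        ∀ (m : ℕ) (p : ℕ → V),
          T.children (p 0) = ∅ → p m = T.root →
          (∀ i < m, T.parent (p i) = some (p (i + 1))) →
          (((Finset.range (m + 1)).filter (fun i => ¬ heavy (p i))).card : ℝ)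
            ≤ C * ν⁻¹ * Real.log n := by
  refine ⟨4, by norm_num, ?_⟩
  intro V _ T ν σ heavy n hν hν1 hn _ _ hroot hleaf hhr hh hl m p hp0 hpm hpar
  have key : ∀ j, j ≤ m → (σ (p 0) : ℝ) ≤
      (1 - ν / 2) ^ ((Finset.range j).filter (fun i => ¬ heavy (p i))).card * (σ (p j) : ℝ) := by
    intro j
    induction j with
    | zero => intro _; simp
    | succ j ih =>
      intro hj
      have h1 := ih (by omega)
      have h2 := hpar j (by omega)
      rw [Finset.range_add_one, Finset.filter_insert]
      by_cases hv : heavy (p j)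
      · have h3 := hh _ _ h2 hv
        rw [if_neg (by simpa using hv), ← h3]
        exact h1
      · have h3 := hl _ _ h2 hv
        rw [if_pos hv, Finset.card_insert_of_notMem (by simp), pow_succ, mul_assoc]
        refine h1.trans (mul_le_mul_of_nonneg_left h3 (pow_nonneg (by linarith) _))
  have hk := key m le_rfl
  have h0 : 1 ≤ σ (p 0) := by
    refine le_trans (Finset.card_pos.mpr ⟨p 0, ?_⟩) (hleaf (p 0))
    unfold RTree.leavesBelow
    rw [Finset.mem_filter]
    exact ⟨Finset.mem_univ _, hp0, Relation.ReflTransGen.refl⟩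
  have h0' : (1 : ℝ) ≤ (σ (p 0) : ℝ) := by exact_mod_cast h0
  have hn2 : (2 : ℝ) ≤ (n : ℝ) := by exact_mod_cast hn
  rw [hpm, hroot] at hk
  rw [Finset.range_add_one, Finset.filter_insert, if_pos (by rw [hpm]; exact hhr),
    Finset.card_insert_of_notMem (by simp)]
  generalize ((Finset.range m).filter (fun i => ¬ heavy (p i))).card = k at hk ⊢
  have h1 : (1 : ℝ) ≤ (1 - ν / 2) ^ k * n := h0'.trans hk
  have hpos : (0 : ℝ) < 1 - ν / 2 := by linarith
  have h2 := Real.log_le_log one_pos h1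
  rw [Real.log_one, Real.log_mul (pow_pos hpos _).ne' (by linarith), Real.log_pow] at h2
  have h3 : Real.log (1 - ν / 2) ≤ -(ν / 2) := by
    have := Real.log_le_sub_one_of_pos hpos
    linarith
  have h4 : (k : ℝ) * Real.log (1 - ν / 2) ≤ k * (-(ν / 2)) :=
    mul_le_mul_of_nonneg_left h3 (Nat.cast_nonneg k)
  have h5 : Real.log 2 ≤ Real.log n := Real.log_le_log (by norm_num) hn2
  have h6 := Real.log_two_gt_d9
  have h7 : 4 * ν⁻¹ * Real.log n = 4 * Real.log n / ν := by ring
  rw [h7, le_div_iff₀ hν]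
  push_cast
  linarith
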